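/- Theorem on local uniqueness of the solution of the interior initial value problem: Let G ⊆ ℝ² be open, f : ℝ² → ℝ continuous on G, and (x₀,y₀) ∈ G a formal uniqueness point, i.e., for any two solutions φ₁, φ₂ of the initial value problem IVP(x₀,y₀) of y' = f(x,y) with graphs in G, defined on intervals I₁ ∋ x₀ and I₂ ∋ x₀, there is an open interval (α,β) ∋ x₀ such that φ₁(x) = φ₂(x) for all x ∈ (α,β) ∩ I₁ ∩ I₂. Then for any Peano segment [x₀−h, x₀+h] there exists δ > 0 such that any two solutions of IVP(x₀,y₀) defined on [x₀−h, x₀+h] with graphs in G coincide on [x₀−δ, x₀+δ]. -/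

import Mathlib

open Set

/-- `φ` is a solution of `y' = f(x,y)` on the set `I ⊆ ℝ` with graph in `S`:
it is differentiable at every point of `I` (one-sided at endpoints, expressed via
`HasDerivWithinAt`), its graph lies in `S`, and it satisfies the equation. -/
def IsSolOn (f : ℝ × ℝ → ℝ) (S : Set (ℝ × ℝ)) (φ : ℝ → ℝ) (I : Set ℝ) : Prop :=
  ∀ x ∈ I, (x, φ x) ∈ S ∧ HasDerivWithinAt φ (f (x, φ x)) I x

open Filter Topology

lemma IsSolOn.mono {f : ℝ × ℝ → ℝ} {S : Set (ℝ × ℝ)} {φ : ℝ → ℝ} {I J : Set ℝ}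
    (hφ : IsSolOn f S φ I) (hJ : J ⊆ I) : IsSolOn f S φ J :=
  fun x hx => ⟨(hφ x (hJ hx)).1, (hφ x (hJ hx)).2.mono hJ⟩

lemma IsSolOn.continuousOn {f : ℝ × ℝ → ℝ} {S : Set (ℝ × ℝ)} {φ : ℝ → ℝ} {I : Set ℝ}
    (hφ : IsSolOn f S φ I) : ContinuousOn φ I :=
  fun x hx => (hφ x hx).2.continuousWithinAt

/-- Reflecting the dependent variable turns solutions into solutions. -/
lemma IsSolOn.neg {f : ℝ × ℝ → ℝ} {S : Set (ℝ × ℝ)} {φ : ℝ → ℝ} {I : Set ℝ}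
    (hφ : IsSolOn f S φ I) :
    IsSolOn (fun p => -f (p.1, -p.2)) ((fun p : ℝ × ℝ => (p.1, -p.2)) ⁻¹' S)
      (fun x => -φ x) I := by
  intro x hx
  obtain ⟨hS, hd⟩ := hφ x hx
  exact ⟨by simpa using hS, by simpa using hd.fun_neg⟩

lemma HasDerivWithinAt.max_of_eq {φ ψ : ℝ → ℝ} {d x : ℝ} {I : Set ℝ}
    (hφ : HasDerivWithinAt φ d I x) (hψ : HasDerivWithinAt ψ d I x) (h : φ x = ψ x) :
    HasDerivWithinAt (fun t => max (φ t) (ψ t)) d I x := by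
  classical
  rw [hasDerivWithinAt_iff_tendsto_slope] at *
  refine (Tendsto.if' (p := fun t => φ t ≤ ψ t) hψ hφ).congr fun t => ?_
  split_ifs with ht
  · simp [slope, h, max_eq_right ht]
  · simp [slope, h, max_eq_left (not_le.1 ht).le]

/-- The maximum of two solutions is a solution. -/
lemma IsSolOn.max {f : ℝ × ℝ → ℝ} {S : Set (ℝ × ℝ)} {φ ψ : ℝ → ℝ} {I : Set ℝ}
    (hφ : IsSolOn f S φ I) (hψ : IsSolOn f S ψ I) :
    IsSolOn f S (fun t => max (φ t) (ψ t)) I := by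
  intro x hx
  obtain ⟨hφS, hφd⟩ := hφ x hx
  obtain ⟨hψS, hψd⟩ := hψ x hx
  rcases lt_trichotomy (φ x) (ψ x) with h | h | h
  · have hev : (fun t => Max.max (φ t) (ψ t)) =ᶠ[𝓝[I] x] ψ := by
      filter_upwards [hφd.continuousWithinAt.eventually_lt hψd.continuousWithinAt h] with t ht
        using max_eq_right ht.le
    simp only [max_eq_right h.le]
    exact ⟨hψS, hψd.congr_of_eventuallyEq hev (max_eq_right h.le)⟩
  · rw [← h] at hψd
    simp only [← h, max_self]
    exact ⟨hφS, hφd.max_of_eq hψd h⟩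
  · have hev : (fun t => Max.max (φ t) (ψ t)) =ᶠ[𝓝[I] x] φ := by
      filter_upwards [hψd.continuousWithinAt.eventually_lt hφd.continuousWithinAt h] with t ht
        using max_eq_left ht.le
    simp only [max_eq_left h.le]
    exact ⟨hφS, hφd.congr_of_eventuallyEq hev (max_eq_left h.le)⟩

/-- A pointwise limit of solutions with graphs in a fixed compact set is a solution. -/
lemma IsSolOn.of_tendsto {f : ℝ × ℝ → ℝ} {K : Set (ℝ × ℝ)} (hK : IsCompact K)
    (hf : ContinuousOn f K) {c d : ℝ} {χ : ℕ → ℝ → ℝ} {ψ : ℝ → ℝ}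
    (hχ : ∀ n, IsSolOn f K (χ n) (Icc c d))
    (hlim : ∀ x ∈ Icc c d, Tendsto (fun n => χ n x) atTop (𝓝 (ψ x))) :
    IsSolOn f K ψ (Icc c d) := by
  obtain ⟨C, hC⟩ := hK.exists_bound_of_continuousOn hf
  have hψK : ∀ x ∈ Icc c d, (x, ψ x) ∈ K := fun x hx =>
    hK.isClosed.mem_of_tendsto (tendsto_const_nhds.prodMk_nhds (hlim x hx))
      (Eventually.of_forall fun n => (hχ n x hx).1)
  have hlip : ∀ x ∈ Icc c d, ∀ y ∈ Icc c d, ‖ψ y - ψ x‖ ≤ C * ‖y - x‖ := fun x hx y hy =>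
    le_of_tendsto ((hlim y hy).sub (hlim x hx)).norm <| Eventually.of_forall fun n =>
      (convex_Icc c d).norm_image_sub_le_of_norm_hasDerivWithin_le
        (fun t ht => (hχ n t ht).2) (fun t ht => hC _ (hχ n t ht).1) hx hy
  have hψc : ContinuousOn ψ (Icc c d) :=
    (LipschitzOnWith.of_dist_le_mul (K := C.toNNReal) fun y hy x hx => by
      rw [dist_eq_norm, dist_eq_norm]
      exact (hlip x hx y hy).trans
        (mul_le_mul_of_nonneg_right (Real.le_coe_toNNReal C) (norm_nonneg _))).continuousOn
  have hcomp : ∀ u : ℝ → ℝ, ContinuousOn u (Icc c d) → (∀ x ∈ Icc c d, (x, u x) ∈ K) →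
      ContinuousOn (fun t => f (t, u t)) (Icc c d) := fun u hu huK =>
    hf.comp (continuousOn_id.prodMk hu) huK
  have hint : ∀ x ∈ Icc c d, ψ x = ψ c + ∫ t in c..x, f (t, ψ t) := by
    intro x hx
    have hsub : Icc c x ⊆ Icc c d := Icc_subset_Icc_right hx.2
    have hFTC : ∀ n, ∫ t in c..x, f (t, χ n t) = χ n x - χ n c := fun n =>
      intervalIntegral.integral_eq_sub_of_hasDerivAt_of_le hx.1
        ((hχ n).continuousOn.mono hsub)
        (fun t ht => (hχ n t (hsub (Ioo_subset_Icc_self ht))).2.hasDerivAt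
          (Icc_mem_nhds ht.1 (ht.2.trans_le hx.2)))
        (((hcomp _ (hχ n).continuousOn fun t ht => (hχ n t ht).1).mono
          hsub).intervalIntegrable_of_Icc hx.1)
    have hI : Tendsto (fun n => ∫ t in c..x, f (t, χ n t)) atTop
        (𝓝 (∫ t in c..x, f (t, ψ t))) := by
      have hmem : ∀ t ∈ Set.uIoc c x, t ∈ Icc c d := fun t ht => by
        rw [uIoc_of_le hx.1] at ht
        exact hsub (Ioc_subset_Icc_self ht)
      refine intervalIntegral.tendsto_integral_filter_of_dominated_convergence (fun _ => C)
        (Eventually.of_forall fun n => ?_) (Eventually.of_forall fun n => ?_)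
        intervalIntegrable_const ?_
      · exact ((hcomp _ (hχ n).continuousOn fun t ht => (hχ n t ht).1).mono
          hmem).aestronglyMeasurable measurableSet_uIoc
      · exact Eventually.of_forall fun t ht => hC _ (hχ n t (hmem t ht)).1
      · refine Eventually.of_forall fun t ht => ?_
        refine (hf _ (hψK t (hmem t ht))).tendsto.comp (tendsto_nhdsWithin_iff.2 ⟨?_, ?_⟩)
        · exact tendsto_const_nhds.prodMk_nhds (hlim t (hmem t ht))
        · exact Eventually.of_forall fun n => (hχ n t (hmem t ht)).1
    have hc : c ∈ Icc c d := ⟨le_rfl, hx.1.trans hx.2⟩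
    have := tendsto_nhds_unique hI
      (((hlim x hx).sub (hlim c hc)).congr fun n => (hFTC n).symm)
    linarith
  intro x hx
  refine ⟨hψK x hx, ?_⟩
  have hFc := hcomp ψ hψc hψK
  have : Fact (x ∈ Icc c d) := ⟨hx⟩
  have hder : HasDerivWithinAt (fun u => ∫ t in c..u, f (t, ψ t)) (f (x, ψ x)) (Icc c d) x :=
    intervalIntegral.integral_hasDerivWithinAt_right
      ((hFc.mono (Icc_subset_Icc_right hx.2)).intervalIntegrable_of_Icc hx.1)
      (hFc.stronglyMeasurableAtFilter_nhdsWithin measurableSet_Icc x) (hFc x hx)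
  exact (hder.const_add (ψ c)).congr hint (hint x hx)

/-- A sequence of solutions with graphs in a fixed compact set has a common upper bound which is
again a solution of the same initial value problem. -/
lemma exists_isSolOn_ge {f : ℝ × ℝ → ℝ} {K : Set (ℝ × ℝ)} (hK : IsCompact K)
    (hf : ContinuousOn f K) {c d x₀ y₀ : ℝ} {w : ℕ → ℝ → ℝ}
    (hw : ∀ n, IsSolOn f K (w n) (Icc c d)) (hw₀ : ∀ n, w n x₀ = y₀) :
    ∃ ψ : ℝ → ℝ, IsSolOn f K ψ (Icc c d) ∧ ψ x₀ = y₀ ∧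
      ∀ n, ∀ x ∈ Icc c d, w n x ≤ ψ x := by
  have hsol : ∀ n, IsSolOn f K (partialSups w n) (Icc c d) := by
    intro n
    induction n with
    | zero => simpa using hw 0
    | succ n ih => rw [partialSups_add_one]; exact ih.max (hw (n + 1))
  have h₀ : ∀ n, partialSups w n x₀ = y₀ := by
    intro n
    induction n with
    | zero => simpa using hw₀ 0
    | succ n ih => rw [partialSups_add_one, Pi.sup_apply, ih, hw₀, sup_idem]
  obtain ⟨B, hB⟩ := (hK.image continuous_snd).bddAbove
  have hbdd : ∀ x ∈ Icc c d, BddAbove (range fun n => partialSups w n x) := by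
    intro x hx
    refine ⟨B, ?_⟩
    rintro _ ⟨n, rfl⟩
    exact hB ⟨_, (hsol n x hx).1, rfl⟩
  refine ⟨fun x => ⨆ n, partialSups w n x, IsSolOn.of_tendsto hK hf hsol fun x hx =>
    tendsto_atTop_ciSup (fun m n hmn => (partialSups w).monotone hmn x) (hbdd x hx), ?_, ?_⟩
  · simp [h₀]
  · exact fun n x hx => (le_partialSups w n x).trans (le_ciSup (hbdd x hx) n)

/-- A sequence of solutions with graphs in a fixed compact set has a common lower bound which is
again a solution of the same initial value problem. -/
lemma exists_isSolOn_le {f : ℝ × ℝ → ℝ} {K : Set (ℝ × ℝ)} (hK : IsCompact K)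
    (hf : ContinuousOn f K) {c d x₀ y₀ : ℝ} {w : ℕ → ℝ → ℝ}
    (hw : ∀ n, IsSolOn f K (w n) (Icc c d)) (hw₀ : ∀ n, w n x₀ = y₀) :
    ∃ ψ : ℝ → ℝ, IsSolOn f K ψ (Icc c d) ∧ ψ x₀ = y₀ ∧
      ∀ n, ∀ x ∈ Icc c d, ψ x ≤ w n x := by
  have hcont : Continuous fun p : ℝ × ℝ => (p.1, -p.2) := by fun_prop
  have hK' : IsCompact ((fun p : ℝ × ℝ => (p.1, -p.2)) ⁻¹' K) := by
    convert hK.image hcont using 1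
    ext ⟨x, y⟩
    constructor
    · exact fun h => ⟨(x, -y), h, by simp⟩
    · rintro ⟨⟨u, v⟩, h, huv⟩
      simp only [Prod.mk.injEq] at huv
      simpa [← huv.1, ← huv.2] using h
  obtain ⟨ψ, hψ, hψ₀, hle⟩ := exists_isSolOn_ge hK'
    (hf.comp hcont.continuousOn fun _ h => h).neg (fun n => (hw n).neg)
    (y₀ := -y₀) (fun n => by rw [hw₀])
  refine ⟨fun x => -ψ x, ?_, by simp [hψ₀], fun n x hx => by linarith [hle n x hx]⟩
  simpa [IsSolOn] using hψ.neg

/-- A solution through the centre of a rectangle on which `|f| ≤ M` stays in the rectangle. -/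
lemma IsSolOn.mem_rectangle {f : ℝ × ℝ → ℝ} {G : Set (ℝ × ℝ)} {x₀ y₀ a b M r : ℝ}
    (hM : 0 ≤ M)
    (hfM : ∀ p ∈ Icc (x₀ - a) (x₀ + a) ×ˢ Icc (y₀ - b) (y₀ + b), |f p| ≤ M)
    (hra : r ≤ a) (hrb : (M + 1) * r ≤ b) {φ : ℝ → ℝ} (hφ₀ : φ x₀ = y₀)
    (hφ : IsSolOn f G φ (Icc (x₀ - r) (x₀ + r))) :
    IsSolOn f (Icc (x₀ - a) (x₀ + a) ×ˢ Icc (y₀ - b) (y₀ + b)) φ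
      (Icc (x₀ - r) (x₀ + r)) := by
  have key : ∀ σ : ℝ, |σ| = 1 → ∀ t ∈ Icc 0 r, ‖φ (x₀ + σ * t) - y₀‖ ≤ (M + 1) * t := by
    intro σ hσ
    have hmaps : MapsTo (fun t => x₀ + σ * t) (Icc 0 r) (Icc (x₀ - r) (x₀ + r)) := by
      intro t ht
      have : |σ * t| ≤ r := by rw [abs_mul, hσ, one_mul, abs_of_nonneg ht.1]; exact ht.2
      have := abs_le.1 this
      constructor <;> linarith
    have hder : ∀ t ∈ Icc 0 r, HasDerivWithinAt (fun t => φ (x₀ + σ * t) - y₀)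
        (f (x₀ + σ * t, φ (x₀ + σ * t)) * σ) (Icc 0 r) t := by
      intro t ht
      have hlin : HasDerivWithinAt (fun t => x₀ + σ * t) σ (Icc 0 r) t := by
        simpa using (((hasDerivAt_id t).const_mul σ).const_add x₀).hasDerivWithinAt
      exact ((hφ _ (hmaps ht)).2.comp t hlin hmaps).sub_const y₀
    intro t ht
    refine image_norm_le_of_norm_deriv_right_lt_deriv_boundary
      (B := fun t => (M + 1) * t) (B' := fun _ => M + 1)
      (fun t ht => (hder t ht).continuousWithinAt)
      (fun t ht => (hder t (Ico_subset_Icc_self ht)).mono_of_mem_nhdsWithin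
        (Icc_mem_nhdsGE_of_mem ht)) (by simp [hφ₀])
      (fun t => by simpa using (hasDerivAt_id t).const_mul (M + 1)) ?_ ht
    intro s hs hsb
    rw [norm_mul, Real.norm_eq_abs, Real.norm_eq_abs, hσ, mul_one]
    refine (hfM _ ⟨?_, ?_⟩).trans_lt (lt_add_one M)
    · have := hmaps (Ico_subset_Icc_self hs)
      exact ⟨by linarith [this.1], by linarith [this.2]⟩
    · have : |φ (x₀ + σ * s) - y₀| ≤ b := by
        rw [← Real.norm_eq_abs, hsb]
        exact (mul_le_mul_of_nonneg_left hs.2.le (by linarith)).trans hrb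
      have := abs_le.1 this
      exact ⟨by linarith [this.1], by linarith [this.2]⟩
  intro x hx
  refine ⟨⟨⟨by linarith [hx.1], by linarith [hx.2]⟩, ?_⟩, (hφ x hx).2⟩
  have habs : |φ x - y₀| ≤ b := by
    rcases le_total x₀ x with h | h
    · have ht : x - x₀ ≤ r := by linarith [hx.2]
      have := key 1 (by simp) (x - x₀) ⟨by linarith, ht⟩
      rw [Real.norm_eq_abs, show x₀ + 1 * (x - x₀) = x by ring] at this
      exact this.trans ((mul_le_mul_of_nonneg_left ht (by linarith)).trans hrb)
    · have ht : x₀ - x ≤ r := by linarith [hx.1]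
      have := key (-1) (by simp) (x₀ - x) ⟨by linarith, ht⟩
      rw [Real.norm_eq_abs, show x₀ + -1 * (x₀ - x) = x by ring] at this
      exact this.trans ((mul_le_mul_of_nonneg_left ht (by linarith)).trans hrb)
  have := abs_le.1 habs
  exact ⟨by linarith [this.1], by linarith [this.2]⟩

/-- Theorem on local uniqueness of the solution of the interior initial value
problem: if `(x₀, y₀) ∈ G` is a formal uniqueness point, then for any Peano
segment `[x₀ - h, x₀ + h]` there is `δ > 0` such that any two solutions of
IVP(x₀,y₀) defined on the Peano segment coincide on `[x₀ - δ, x₀ + δ]`. -/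
theorem local_uniqueness_interior_ivp
    (G : Set (ℝ × ℝ)) (hG : IsOpen G) (f : ℝ × ℝ → ℝ) (hf : ContinuousOn f G)
    (x₀ y₀ : ℝ) (h₀ : (x₀, y₀) ∈ G)
    (hformal : ∀ (I₁ I₂ : Set ℝ) (φ₁ φ₂ : ℝ → ℝ),
      I₁.OrdConnected → x₀ ∈ I₁ → I₂.OrdConnected → x₀ ∈ I₂ →
      φ₁ x₀ = y₀ → φ₂ x₀ = y₀ → IsSolOn f G φ₁ I₁ → IsSolOn f G φ₂ I₂ →
      ∃ α β : ℝ, α < x₀ ∧ x₀ < β ∧ ∀ x ∈ Ioo α β ∩ I₁ ∩ I₂, φ₁ x = φ₂ x)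
    (a b : ℝ) (ha : 0 < a) (hb : 0 < b)
    (hR : Icc (x₀ - a) (x₀ + a) ×ˢ Icc (y₀ - b) (y₀ + b) ⊆ G)
    (M : ℝ)
    (hM : M = sSup ((fun p => |f p|) '' (Icc (x₀ - a) (x₀ + a) ×ˢ Icc (y₀ - b) (y₀ + b))))
    (h : ℝ) (hh : h = if M = 0 then a else min a (b / M)) :
    ∃ δ > 0, ∀ φ₁ φ₂ : ℝ → ℝ,
      φ₁ x₀ = y₀ → φ₂ x₀ = y₀ →
      IsSolOn f G φ₁ (Icc (x₀ - h) (x₀ + h)) → IsSolOn f G φ₂ (Icc (x₀ - h) (x₀ + h)) →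
      ∀ x ∈ Icc (x₀ - δ) (x₀ + δ), φ₁ x = φ₂ x := by
  set R := Icc (x₀ - a) (x₀ + a) ×ˢ Icc (y₀ - b) (y₀ + b)
  have hRK : IsCompact R := isCompact_Icc.prod isCompact_Icc
  have hfR : ContinuousOn f R := hf.mono hR
  have hfM : ∀ p ∈ R, |f p| ≤ M := fun p hp =>
    hM ▸ le_csSup (hRK.image_of_continuousOn hfR.abs).bddAbove ⟨p, hp, rfl⟩
  have hM0 : 0 ≤ M := (abs_nonneg _).trans
    (hfM (x₀, y₀) ⟨⟨by linarith, by linarith⟩, ⟨by linarith, by linarith⟩⟩)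
  obtain ⟨r, hr, hra, hrb, hrh⟩ : ∃ r > 0, r ≤ a ∧ (M + 1) * r ≤ b ∧ r ≤ h := by
    refine ⟨min a (b / (M + 1)), by positivity, min_le_left _ _, ?_, ?_⟩
    · rw [mul_comm, ← le_div_iff₀ (by positivity)]
      exact min_le_right _ _
    · rw [hh]
      split_ifs with hM'
      · exact min_le_left _ _
      · have : 0 < M := lt_of_le_of_ne hM0 (Ne.symm hM')
        gcongr
        linarith
  have hsub : Icc (x₀ - r) (x₀ + r) ⊆ Icc (x₀ - h) (x₀ + h) :=
    Icc_subset_Icc (by linarith) (by linarith)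
  have hx₀ : x₀ ∈ Icc (x₀ - r) (x₀ + r) := ⟨by linarith, by linarith⟩
  by_contra! hcon
  choose! u v hu₀ hv₀ hu hv x hx hne using fun n : ℕ =>
    hcon (r / (n + 1)) (by positivity)
  have hrect : ∀ φ : ℝ → ℝ, φ x₀ = y₀ → IsSolOn f G φ (Icc (x₀ - h) (x₀ + h)) →
      IsSolOn f R φ (Icc (x₀ - r) (x₀ + r)) := fun φ hφ₀ hφ =>
    (hφ.mono hsub).mem_rectangle hM0 hfM hra hrb hφ₀
  have huR := fun n => hrect _ (hu₀ n) (hu n)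
  have hvR := fun n => hrect _ (hv₀ n) (hv n)
  obtain ⟨p, hp, hp₀, hup⟩ := exists_isSolOn_ge hRK hfR huR hu₀
  obtain ⟨p', hp', hp₀', hvp⟩ := exists_isSolOn_ge hRK hfR hvR hv₀
  obtain ⟨q, hq, hq₀, huq⟩ := exists_isSolOn_le hRK hfR huR hu₀
  obtain ⟨q', hq', hq₀', hvq⟩ := exists_isSolOn_le hRK hfR hvR hv₀
  have hcoin : ∀ φ₁ φ₂ : ℝ → ℝ, φ₁ x₀ = y₀ → φ₂ x₀ = y₀ →
      IsSolOn f R φ₁ (Icc (x₀ - r) (x₀ + r)) → IsSolOn f R φ₂ (Icc (x₀ - r) (x₀ + r)) →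
      ∀ᶠ t in 𝓝 x₀, φ₁ t = φ₂ t := by
    intro φ₁ φ₂ h₁ h₂ hs₁ hs₂
    obtain ⟨α, β, hα, hβ, heq⟩ := hformal _ _ φ₁ φ₂ ordConnected_Icc hx₀ ordConnected_Icc hx₀
      h₁ h₂ (fun t ht => ⟨hR (hs₁ t ht).1, (hs₁ t ht).2⟩)
      (fun t ht => ⟨hR (hs₂ t ht).1, (hs₂ t ht).2⟩)
    filter_upwards [Ioo_mem_nhds hα hβ,
      Icc_mem_nhds (show x₀ - r < x₀ by linarith) (show x₀ < x₀ + r by linarith)] with t ht ht'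
    exact heq t ⟨⟨ht, ht'⟩, ht'⟩
  have hlim : Tendsto x atTop (𝓝 x₀) := by
    have hz : Tendsto (fun n : ℕ => r / ((n : ℝ) + 1)) atTop (𝓝 0) := by
      simpa [div_eq_mul_inv] using tendsto_one_div_add_atTop_nhds_zero_nat.const_mul r
    refine tendsto_of_tendsto_of_tendsto_of_le_of_le (g := fun n : ℕ => x₀ - r / ((n : ℝ) + 1))
      (h := fun n : ℕ => x₀ + r / ((n : ℝ) + 1)) ?_ ?_ (fun n => (hx n).1) (fun n => (hx n).2)
    · simpa using hz.const_sub x₀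
    · simpa using hz.const_add x₀
  obtain ⟨n, h₁, h₂, h₃, hn⟩ := (hlim.eventually ((hcoin p q hp₀ hq₀ hp hq).and
    ((hcoin p p' hp₀ hp₀' hp hp').and ((hcoin p q' hp₀ hq₀' hp hq').and
      (Icc_mem_nhds (show x₀ - r < x₀ by linarith) (show x₀ < x₀ + r by linarith)))))).exists
  exact hne n (by linarith [hup n _ hn, hvp n _ hn, huq n _ hn, hvq n _ hn])
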